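/- For every integer k ≥ 113 such that k − 2 is a power of a prime, there exists a (k+3, k) systematic double-error-correcting code, i.e., a code C ⊆ S_{k+3} of size k! such that for every σ ∈ S_k there is exactly one α ∈ C with α_{↓k} = σ, and distinct codewords of C have Kendall τ-distance at least 5. -/

import Mathlib

/-- `AdjTrans σ π` : the sequence `π` is obtained from the sequence `σ` by exchanging
two distinct adjacent elements (an adjacent transposition). -/
def AdjTrans (σ π : List ℤ) : Prop :=
  ∃ (l₁ l₂ : List ℤ) (a b : ℤ), a ≠ b ∧ σ = l₁ ++ a :: b :: l₂ ∧ π = l₁ ++ b :: a :: l₂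

/-- `StepsTo n σ π` : `π` can be obtained from `σ` by a sequence of `n` adjacent
transpositions. -/
def StepsTo : ℕ → List ℤ → List ℤ → Prop
  | 0 => fun σ π => σ = π
  | n + 1 => fun σ π => ∃ τ, AdjTrans σ τ ∧ StepsTo n τ π

/-- The Kendall τ-distance between two sequences: the minimum number of adjacent
transpositions needed to transform one into the other. -/
noncomputable def dK (σ π : List ℤ) : ℕ := sInf {n | StepsTo n σ π}

/-- The list `[a, a+1, ..., a+len-1]` of integers. -/
def rangeList (a len : ℕ) : List ℤ := (List.range' a len).map (fun x => (x : ℤ))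

/-- The substitution map `T_θ`: the `r`-th occurrence (from the left, `0`-indexed) of a
rank `a` in `σ` is replaced by the `r`-th entry of the list `θ a`. -/
def Tmap (θ : ℤ → List ℤ) (σ : List ℤ) : List ℤ :=
  (List.range σ.length).map (fun j =>
    (θ (σ.getD j 0)).getD ((σ.take j).count (σ.getD j 0)) 0)

/-- `psiEntry σ a s` : the number of positions in `σ` strictly to the right of the `s`-th
occurrence (`0`-indexed) of `a` in `σ` that hold an element smaller than `a`. -/
def psiEntry (σ : List ℤ) (a : ℤ) (s : ℕ) : ℕ :=
  (σ.drop (((σ.indexesOf a).getD s σ.length) + 1)).countP (fun x => decide (x < a))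

/-- The Manhattan distance between two vectors of naturals (presented as lists). -/
def manhattanL (x y : List ℕ) : ℕ :=
  ∑ i ∈ Finset.range (max x.length y.length), ((x.getD i 0 : ℤ) - (y.getD i 0 : ℤ)).natAbs

/-- The Lee distance over `Z_q` between two vectors with entries in `{0, …, q-1}`
(presented as lists). -/
def leeDistL (q : ℕ) (x y : List ℕ) : ℕ :=
  ∑ i ∈ Finset.range (max x.length y.length),
    min (((x.getD i 0 : ℤ) - (y.getD i 0 : ℤ)).natAbs)
      (q - ((x.getD i 0 : ℤ) - (y.getD i 0 : ℤ)).natAbs)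

/-- The Lee distance between two vectors over `ZMod q`. -/
def zmodLee {q N : ℕ} (x y : Fin N → ZMod q) : ℕ :=
  ∑ i, min (x i - y i).val (y i - x i).val

/-- `permList k σ` : `σ` is (an ordering representing) a permutation of `{1, …, k}`. -/
def permList (k : ℕ) (σ : List ℤ) : Prop :=
  (↑σ : Multiset ℤ) = (↑(rangeList 1 k) : Multiset ℤ)

/-- The multiset `M_{k,r} = {0^k, k+1, …, k+r}`. -/
def Mkr (k r : ℕ) : Multiset ℤ :=
  Multiset.replicate k (0 : ℤ) + (↑(rangeList (k + 1) r) : Multiset ℤ)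

/-- `α_{↓k}` : delete from `α` all elements larger than `k`. -/
def restrictTo (k : ℕ) (α : List ℤ) : List ℤ :=
  α.filter (fun x => decide (x ≤ (k : ℤ)))

/-- `α_{k↦0}` : replace in `α` every element of `{1, …, k}` by `0`. -/
def mapToZero (k : ℕ) (α : List ℤ) : List ℤ :=
  α.map (fun x => if 1 ≤ x ∧ x ≤ (k : ℤ) then 0 else x)

/-- `star σ ρ = σ ∗ ρ` : replace the zeros of `ρ`, from left to right, by the elements
of `σ` in order. -/
def starP : List ℤ → List ℤ → List ℤ
  | _, [] => []
  | σ, x :: ρ' => if x = 0 then σ.headD 0 :: starP σ.tail ρ' else x :: starP σ ρ'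

def invv (a : ℤ) : List ℤ → ℕ
  | [] => 0
  | b :: l => if b = a then l.countP (fun x => decide (x < a)) else invv a l

theorem invv_append_notMem (a : ℤ) (l m : List ℤ) (h : a ∉ l) : invv a (l ++ m) = invv a m := by
  induction l with
  | nil => rfl
  | cons b l ih =>
    simp only [List.mem_cons, not_or] at h
    simp only [List.cons_append, invv]
    rw [if_neg (fun e => h.1 e.symm), ih h.2]

theorem invv_append_mem (a : ℤ) (l m : List ℤ) (h : a ∈ l) :
    invv a (l ++ m) = invv a l + m.countP (fun x => decide (x < a)) := by
  induction l with
  | nil => simp at h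
  | cons b l ih =>
    simp only [List.cons_append, invv]
    by_cases e : b = a
    · simp [e]
    · rw [if_neg e, if_neg e]
      apply ih
      simp only [List.mem_cons] at h
      rcases h with h | h
      · exact absurd h.symm e
      · exact h

theorem invv_filter (a k : ℤ) (hak : a ≤ k) (l : List ℤ) :
    invv a (l.filter (fun x => decide (x ≤ k))) = invv a l := by
  induction l with
  | nil => rfl
  | cons b l ih =>
    by_cases hb : b ≤ k
    · rw [List.filter_cons_of_pos (by simpa using hb)]
      simp only [invv]
      rw [ih]
      congr 1
      rw [List.countP_filter]
      apply List.countP_congr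
      intro x _
      simp
      intro h; omega
    · rw [List.filter_cons_of_neg (by simpa using hb), ih]
      simp only [invv]
      rw [if_neg (by omega)]

theorem invv_le (a : ℤ) (l : List ℤ) : invv a l ≤ l.countP (fun x => decide (x < a)) := by
  induction l with
  | nil => simp [invv]
  | cons b l ih =>
    simp only [invv, List.countP_cons]
    split_ifs <;> omega

/-- effect of a single adjacent transposition -/
theorem invv_swap (l₁ l₂ : List ℤ) (a b : ℤ) (hab : a < b)
    (hn : (l₁ ++ a :: b :: l₂).Nodup) (c : ℤ) :
    invv c (l₁ ++ b :: a :: l₂) = invv c (l₁ ++ a :: b :: l₂) + if c = b then 1 else 0 := by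
  rw [List.nodup_append] at hn
  obtain ⟨_, hn2, hd⟩ := hn
  by_cases hc : c ∈ l₁
  · have hcb : c ≠ b := hd c hc b (by simp)
    rw [invv_append_mem _ _ _ hc, invv_append_mem _ _ _ hc, if_neg hcb]
    simp only [List.countP_cons]
    omega
  · rw [invv_append_notMem _ _ _ hc, invv_append_notMem _ _ _ hc]
    simp only [invv, List.countP_cons]
    by_cases h1 : c = b
    · subst h1
      simp [hab, hab.ne]
    · have : ¬ b = c := fun e => h1 e.symm
      by_cases h2 : a = c
      · subst h2
        have : ¬ b < a := by omega
        simp [*]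
      · simp [*]

theorem adj_nodup {σ π : List ℤ} (h : AdjTrans σ π) (hn : σ.Nodup) : π.Nodup := by
  obtain ⟨l₁, l₂, a, b, _, rfl, rfl⟩ := h
  refine (List.Perm.nodup_iff ?_).1 hn
  exact List.Perm.append_left _ (List.Perm.swap _ _ _)

theorem adj_dist {σ π : List ℤ} (h : AdjTrans σ π) (hn : σ.Nodup) (s : Finset ℤ) :
    ∑ c ∈ s, |(invv c σ : ℤ) - invv c π| ≤ 1 := by
  have hn' := adj_nodup h hn
  obtain ⟨l₁, l₂, a, b, hab, rfl, rfl⟩ := h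
  rcases lt_or_gt_of_ne hab with h | h
  · have : ∀ c ∈ s, |(invv c (l₁ ++ a :: b :: l₂) : ℤ) - invv c (l₁ ++ b :: a :: l₂)|
        = if c = b then 1 else 0 := by
      intro c _
      rw [invv_swap l₁ l₂ a b h hn c]
      split_ifs <;> simp
    rw [Finset.sum_congr rfl this, Finset.sum_ite_eq']
    split_ifs <;> simp
  · have : ∀ c ∈ s, |(invv c (l₁ ++ a :: b :: l₂) : ℤ) - invv c (l₁ ++ b :: a :: l₂)|
        = if c = a then 1 else 0 := by
      intro c _
      rw [invv_swap l₁ l₂ b a h hn' c]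
      split_ifs <;> simp
    rw [Finset.sum_congr rfl this, Finset.sum_ite_eq']
    split_ifs <;> simp

theorem steps_dist (n : ℕ) (σ π : List ℤ) (h : StepsTo n σ π) (hn : σ.Nodup) (s : Finset ℤ) :
    ∑ c ∈ s, |(invv c σ : ℤ) - invv c π| ≤ n := by
  induction n generalizing σ with
  | zero =>
    have : σ = π := h
    subst this
    simp
  | succ n ih =>
    obtain ⟨τ, h1, h2⟩ := h
    have e1 := adj_dist h1 hn s
    have e2 := ih τ h2 (adj_nodup h1 hn)
    have : ∑ c ∈ s, |(invv c σ : ℤ) - invv c π| ≤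
        ∑ c ∈ s, (|(invv c σ : ℤ) - invv c τ| + |(invv c τ : ℤ) - invv c π|) :=
      Finset.sum_le_sum (fun c _ => abs_sub_le _ _ _)
    rw [Finset.sum_add_distrib] at this
    push_cast
    linarith

theorem steps_trans (n m : ℕ) (σ τ π : List ℤ) (h : StepsTo n σ τ) (h' : StepsTo m τ π) :
    StepsTo (n + m) σ π := by
  induction n generalizing σ with
  | zero =>
    have : σ = τ := h
    subst this
    simpa using h'
  | succ n ih =>
    obtain ⟨ρ, h1, h2⟩ := h
    rw [Nat.add_right_comm]
    exact ⟨ρ, h1, ih ρ h2⟩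

theorem steps_cons (n : ℕ) (x : ℤ) (σ π : List ℤ) (h : StepsTo n σ π) :
    StepsTo n (x :: σ) (x :: π) := by
  induction n generalizing σ with
  | zero =>
    have : σ = π := h
    subst this
    rfl
  | succ n ih =>
    obtain ⟨ρ, ⟨l₁, l₂, a, b, hab, rfl, rfl⟩, h2⟩ := h
    exact ⟨_, ⟨x :: l₁, l₂, a, b, hab, rfl, rfl⟩, ih _ h2⟩

theorem steps_exists {σ π : List ℤ} (h : σ.Perm π) : ∃ n, StepsTo n σ π := by
  induction h with
  | nil => exact ⟨0, rfl⟩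
  | cons x _ ih =>
    obtain ⟨n, hn⟩ := ih
    exact ⟨n, steps_cons n x _ _ hn⟩
  | swap x y l =>
    by_cases e : y = x
    · subst e; exact ⟨0, rfl⟩
    · exact ⟨1, _, ⟨[], l, y, x, e, rfl, rfl⟩, rfl⟩
  | trans _ _ ih1 ih2 =>
    obtain ⟨n, hn⟩ := ih1
    obtain ⟨m, hm⟩ := ih2
    exact ⟨n + m, steps_trans n m _ _ _ hn hm⟩

theorem rangeList_eq (a n : ℕ) :
    rangeList a n = (List.range' a n).map (fun x : ℕ => (x : ℤ)) := by
  unfold rangeList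
  rw [List.map_id']
  exact List.flatMap_pure_eq_map _ _

theorem permList_mem {k : ℕ} {σ : List ℤ} (h : permList k σ) (x : ℤ) :
    x ∈ σ ↔ 1 ≤ x ∧ x ≤ k := by
  have hp : σ.Perm (rangeList 1 k) := Multiset.coe_eq_coe.1 h
  rw [hp.mem_iff]
  simp only [rangeList_eq, List.mem_map, List.mem_range'_1]
  constructor
  · rintro ⟨y, hy, rfl⟩; omega
  · intro hx; exact ⟨x.toNat, by omega, by omega⟩

theorem rangeList_nodup (k : ℕ) : (rangeList 1 k).Nodup :=
  rangeList_eq 1 k ▸ List.Nodup.map Nat.cast_injective List.nodup_range'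

theorem permList_nodup {k : ℕ} {σ : List ℤ} (h : permList k σ) : σ.Nodup :=
  (Multiset.coe_eq_coe.1 h).nodup_iff.2 (rangeList_nodup k)

theorem permList_length {k : ℕ} {σ : List ℤ} (h : permList k σ) : σ.length = k := by
  rw [(Multiset.coe_eq_coe.1 h).length_eq]; simp [rangeList_eq]

theorem permList_of {k : ℕ} {σ : List ℤ} (hn : σ.Nodup) (h : ∀ x, x ∈ σ ↔ 1 ≤ x ∧ x ≤ k) :
    permList k σ := by
  apply Multiset.coe_eq_coe.2
  rw [List.perm_ext_iff_of_nodup hn (rangeList_nodup k)]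
  intro x
  rw [h, ← permList_mem (σ := rangeList 1 k) rfl]

theorem permList_restrict {k : ℕ} {σ : List ℤ} (h : permList (k + 1) σ) :
    permList k (restrictTo k σ) := by
  apply permList_of
  · exact (permList_nodup h).filter _
  · intro x
    simp only [restrictTo, List.mem_filter, permList_mem h, decide_eq_true_eq]
    push_cast
    omega

theorem invv_bound {k : ℕ} {σ : List ℤ} (h : permList k σ) (a : ℤ) :
    invv a σ ≤ (a - 1).toNat := by
  refine (invv_le a σ).trans ?_
  rw [List.countP_eq_length_filter]
  rw [← List.toFinset_card_of_nodup ((permList_nodup h).filter _)]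
  rw [← Int.card_Ico]
  apply Finset.card_le_card
  intro x hx
  simp [permList_mem h] at hx
  simp
  omega

theorem filter_all {k : ℕ} {l : List ℤ} (h : ∀ x ∈ l, x ≤ (k : ℤ)) : restrictTo k l = l := by
  simpa [restrictTo, List.filter_eq_self] using h

theorem restrict_split {k : ℕ} {σ l₁ l₂ : List ℤ} (h : permList (k + 1) σ)
    (e : σ = l₁ ++ ((k + 1 : ℕ) : ℤ) :: l₂) :
    restrictTo k σ = l₁ ++ l₂ ∧ invv ((k + 1 : ℕ) : ℤ) σ = l₂.length := by
  have hn := permList_nodup h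
  have hm := permList_mem h
  subst e
  rw [List.nodup_append] at hn
  obtain ⟨_, hn2, hd⟩ := hn
  rw [List.nodup_cons] at hn2
  have h1 : ∀ x ∈ l₁, x < ((k + 1 : ℕ) : ℤ) := by
    intro x hx
    have := hd x hx _ List.mem_cons_self
    have := (hm x).1 (by simp [hx])
    omega
  have h2 : ∀ x ∈ l₂, x < ((k + 1 : ℕ) : ℤ) := by
    intro x hx
    have : x ≠ ((k + 1 : ℕ) : ℤ) := fun e => hn2.1 (e ▸ hx)
    have := (hm x).1 (by simp [hx])
    omega
  constructor
  · unfold restrictTo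
    rw [List.filter_append, List.filter_cons_of_neg (by simp)]
    congr 1
    · exact filter_all (k := k) (fun x hx => by have := h1 x hx; push_cast at this; omega)
    · exact filter_all (k := k) (fun x hx => by have := h2 x hx; push_cast at this; omega)
  · rw [invv_append_notMem]
    · simp only [invv, if_true]
      rw [List.countP_eq_length]
      simpa using h2
    · intro hx; exact absurd (h1 _ hx) (lt_irrefl _)

theorem invv_inj (k : ℕ) (σ π : List ℤ) (h : permList k σ) (h' : permList k π)
    (he : ∀ a : ℤ, 1 ≤ a → a ≤ k → invv a σ = invv a π) : σ = π := by
  induction k generalizing σ π with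
  | zero =>
    have h1 := permList_length h
    have h2 := permList_length h'
    rw [List.length_eq_zero_iff] at h1 h2
    rw [h1, h2]
  | succ k ih =>
    have hr := ih _ _ (permList_restrict h) (permList_restrict h') (by
      intro a ha1 ha2
      rw [restrictTo, restrictTo, invv_filter a k ha2, invv_filter a k ha2]
      exact he a ha1 (by push_cast; omega))
    obtain ⟨l₁, l₂, e⟩ := List.append_of_mem ((permList_mem h ((k + 1 : ℕ) : ℤ)).2 (by push_cast; omega))
    obtain ⟨m₁, m₂, epi⟩ := List.append_of_mem ((permList_mem h' ((k + 1 : ℕ) : ℤ)).2 (by push_cast; omega))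
    obtain ⟨a1, a2⟩ := restrict_split h e
    obtain ⟨b1, b2⟩ := restrict_split h' epi
    have hl := he ((k + 1 : ℕ) : ℤ) (by push_cast; omega) le_rfl
    rw [a2, b2] at hl
    rw [a1, b1] at hr
    obtain ⟨rfl, rfl⟩ := List.append_inj' hr hl
    rw [e, epi]

/-- insert `m` with `y` entries to its right -/
def insR (m : ℤ) (y : ℕ) (l : List ℤ) : List ℤ :=
  l.take (l.length - y) ++ m :: l.drop (l.length - y)

theorem insR_spec {k : ℕ} {σ : List ℤ} (h : permList k σ) (y : ℕ) (hy : y ≤ k) :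
    permList (k + 1) (insR ((k + 1 : ℕ) : ℤ) y σ) ∧
    restrictTo k (insR ((k + 1 : ℕ) : ℤ) y σ) = σ ∧
    invv ((k + 1 : ℕ) : ℤ) (insR ((k + 1 : ℕ) : ℤ) y σ) = y := by
  have hp : (insR ((k + 1 : ℕ) : ℤ) y σ).Perm (((k + 1 : ℕ) : ℤ) :: σ) := by
    unfold insR
    refine List.perm_middle.trans ?_
    rw [List.take_append_drop]
  have h1 : permList (k + 1) (insR ((k + 1 : ℕ) : ℤ) y σ) := by
    apply permList_of
    · rw [hp.nodup_iff, List.nodup_cons]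
      refine ⟨?_, permList_nodup h⟩
      rw [permList_mem h]; push_cast; omega
    · intro x
      rw [hp.mem_iff, List.mem_cons, permList_mem h]; push_cast; omega
  obtain ⟨a, b⟩ := restrict_split h1 rfl
  refine ⟨h1, ?_, ?_⟩
  · rw [a, List.take_append_drop]
  · rw [b, List.length_drop, permList_length h]; omega

def enc (k : ℕ) (y : ℕ × ℕ × ℕ) (σ : List ℤ) : List ℤ :=
  insR ((k + 2 + 1 : ℕ) : ℤ) y.2.2 (insR ((k + 1 + 1 : ℕ) : ℤ) y.2.1
    (insR ((k + 1 : ℕ) : ℤ) y.1 σ))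

theorem invv_of_restrict {k : ℕ} {σ α : List ℤ} (h : restrictTo k α = σ) (a : ℤ) (ha : a ≤ k) :
    invv a α = invv a σ := by
  rw [← h, restrictTo, invv_filter a k ha]

theorem restrict_restrict {k m : ℕ} (hkm : k ≤ m) (α : List ℤ) :
    restrictTo k (restrictTo m α) = restrictTo k α := by
  unfold restrictTo
  rw [List.filter_filter]
  apply List.filter_congr
  intro x _
  simp
  omega

theorem enc_spec {k : ℕ} {σ : List ℤ} (h : permList k σ) (y : ℕ × ℕ × ℕ)
    (h1 : y.1 ≤ k) (h2 : y.2.1 ≤ k + 1) (h3 : y.2.2 ≤ k + 2) :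
    permList (k + 3) (enc k y σ) ∧ restrictTo k (enc k y σ) = σ ∧
    (∀ a : ℤ, a ≤ k → invv a (enc k y σ) = invv a σ) ∧
    invv ((k : ℤ) + 1) (enc k y σ) = y.1 ∧ invv ((k : ℤ) + 2) (enc k y σ) = y.2.1 ∧
    invv ((k : ℤ) + 3) (enc k y σ) = y.2.2 := by
  obtain ⟨p1, r1, i1⟩ := insR_spec h y.1 h1
  obtain ⟨p2, r2, i2⟩ := insR_spec p1 y.2.1 h2
  obtain ⟨p3, r3, i3⟩ := insR_spec p2 y.2.2 h3
  have r : restrictTo k (enc k y σ) = σ := by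
    rw [← restrict_restrict (show k ≤ k + 2 by omega)]
    unfold enc
    erw [r3]
    rw [← restrict_restrict (show k ≤ k + 1 by omega), r2, r1]
  refine ⟨p3, r, fun a ha => invv_of_restrict r a ha, ?_, ?_, ?_⟩
  · rw [enc, show (k : ℤ) + 1 = ((k + 1 : ℕ) : ℤ) by push_cast; rfl]
    rw [invv_of_restrict r3 _ (by push_cast; omega), invv_of_restrict r2 _ le_rfl, i1]
  · rw [enc, show (k : ℤ) + 2 = ((k + 1 + 1 : ℕ) : ℤ) by push_cast; ring]
    rw [invv_of_restrict r3 _ le_rfl, i2]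
  · rw [enc, show (k : ℤ) + 3 = ((k + 2 + 1 : ℕ) : ℤ) by push_cast; ring]
    exact i3

theorem ncard_perm (k : ℕ) : {σ : List ℤ | permList k σ}.ncard = Nat.factorial k := by
  have : {σ : List ℤ | permList k σ} = ((rangeList 1 k).permutations.toFinset : Set (List ℤ)) := by
    ext σ
    simp [permList, List.mem_permutations]
  rw [this, Set.ncard_coe_finset, List.toFinset_card_of_nodup, List.length_permutations]
  · simp [rangeList_eq]
  · exact List.nodup_permutations _ (rangeList_nodup k)

/-- Bose–Chowla Sidon set. -/
theorem sidon_exists (q : ℕ) (hq : IsPrimePow q) :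
    ∃ (G : Type) (_ : CommGroup G) (_ : Fintype G) (h : Fin q → G),
      Fintype.card G = q ^ 2 - 1 ∧
      ∀ a b c d, h a * h b = h c * h d → (a = c ∧ b = d) ∨ (a = d ∧ b = c) := by
  classical
  rw [isPrimePow_nat_iff] at hq
  obtain ⟨p, n, hp, hn, rfl⟩ := hq
  have : Fact p.Prime := ⟨hp⟩
  let F := GaloisField p n
  let K := FiniteField.Extension F p 2
  have hF : Nat.card F = p ^ n := GaloisField.card p n hn.ne'
  have hK : Nat.card K = (p ^ n) ^ 2 := by rw [FiniteField.natCard_extension, hF]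
  let : Fintype F := Fintype.ofFinite F
  let : Fintype K := Fintype.ofFinite K
  have hF' : Fintype.card F = p ^ n := by rw [← hF, Nat.card_eq_fintype_card]
  have hK' : Fintype.card K = (p ^ n) ^ 2 := by rw [← hK, Nat.card_eq_fintype_card]
  have hq1 : 1 < p ^ n := Nat.one_lt_pow hn.ne' hp.one_lt
  obtain ⟨θ, hθ⟩ : ∃ θ : K, ∀ a : F, algebraMap F K a ≠ θ := by
    by_contra hcon
    push Not at hcon
    have := Fintype.card_le_of_surjective (algebraMap F K) hcon
    rw [hF', hK'] at this
    nlinarith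
  have hne : ∀ a : F, θ + algebraMap F K a ≠ 0 := by
    intro a ha
    apply hθ (-a)
    rw [map_neg]
    exact (eq_neg_of_add_eq_zero_left ha).symm
  let e : Fin (p ^ n) ≃ F := (Fintype.equivFinOfCardEq hF').symm
  refine ⟨Kˣ, inferInstance, inferInstance, fun i => Units.mk0 _ (hne (e i)), ?_, ?_⟩
  · rw [Fintype.card_units, hK']
  · intro a b c d habcd
    have h1 := congrArg Units.val habcd
    simp only [Units.val_mul, Units.val_mk0] at h1
    set x := e a with hx
    set y := e b with hy
    set z := e c with hz
    set w := e d with hw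
    have h2 : algebraMap F K (x + y - z - w) * θ = algebraMap F K (z * w - x * y) := by
      simp only [map_sub, map_add, map_mul]
      linear_combination h1
    have h3 : x + y - z - w = 0 := by
      by_contra h0
      apply hθ ((z * w - x * y) / (x + y - z - w))
      rw [map_div₀, ← h2]
      exact mul_div_cancel_left₀ _ (by simpa using (map_ne_zero (algebraMap F K)).2 h0)
    have h4 : z * w - x * y = 0 := by
      rw [h3, map_zero, zero_mul] at h2
      exact (map_eq_zero (algebraMap F K)).1 h2.symm
    have h5 : (x - z) * (x - w) = 0 := by linear_combination x * h3 + h4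
    rcases mul_eq_zero.1 h5 with h | h
    · left
      have e1 : x = z := sub_eq_zero.1 h
      have e2 : y = w := by linear_combination h3 - h
      exact ⟨e.injective e1, e.injective e2⟩
    · right
      have e1 : x = w := sub_eq_zero.1 h
      have e2 : y = z := by linear_combination h3 - h
      exact ⟨e.injective e1, e.injective e2⟩

theorem sidon_L1 {q : ℕ} {G : Type} [CommGroup G] (h : Fin q → G)
    (hs : ∀ a b c d, h a * h b = h c * h d → (a = c ∧ b = d) ∨ (a = d ∧ b = c))
    (x y : Fin q → ℕ) (hd : ∑ i, |(x i : ℤ) - y i| ≤ 4)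
    (h5 : ((∑ i, x i : ℕ) : ZMod 5) = ((∑ i, y i : ℕ) : ZMod 5))
    (hp : ∏ i, h i ^ x i = ∏ i, h i ^ y i) : x = y := by
  classical
  let P : Multiset (Fin q) := ∑ i, Multiset.replicate (x i - y i) i
  let N : Multiset (Fin q) := ∑ i, Multiset.replicate (y i - x i) i
  have cP : P.card = ∑ i, (x i - y i) := by simp [P]
  have cN : N.card = ∑ i, (y i - x i) := by simp [N]
  have kP : ∀ i, P.count i = x i - y i := by
    intro i; simp [P, Multiset.count_sum', Multiset.count_replicate]
  have kN : ∀ i, N.count i = y i - x i := by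
    intro i; simp [N, Multiset.count_sum', Multiset.count_replicate]
  have pP : (P.map h).prod = ∏ i, h i ^ (x i - y i) := by
    have : P.map h = ∑ i, Multiset.replicate (x i - y i) (h i) := by
      simp only [P]
      rw [← Multiset.coe_mapAddMonoidHom, map_sum]
      simp
    rw [this, Multiset.prod_sum]
    simp
  have pN : (N.map h).prod = ∏ i, h i ^ (y i - x i) := by
    have : N.map h = ∑ i, Multiset.replicate (y i - x i) (h i) := by
      simp only [N]
      rw [← Multiset.coe_mapAddMonoidHom, map_sum]
      simp
    rw [this, Multiset.prod_sum]
    simp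
  have hprod : (P.map h).prod = (N.map h).prod := by
    rw [pP, pN]
    have e1 : ∏ i, h i ^ x i = (∏ i, h i ^ (x i - y i)) * ∏ i, h i ^ (min (x i) (y i)) := by
      rw [← Finset.prod_mul_distrib]
      refine Finset.prod_congr rfl fun i _ => ?_
      rw [← pow_add]; congr 1; omega
    have e2 : ∏ i, h i ^ y i = (∏ i, h i ^ (y i - x i)) * ∏ i, h i ^ (min (x i) (y i)) := by
      rw [← Finset.prod_mul_distrib]
      refine Finset.prod_congr rfl fun i _ => ?_
      rw [← pow_add]; congr 1; omega
    rw [e1, e2] at hp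
    exact mul_right_cancel hp
  have hsum : P.card + N.card ≤ 4 := by
    rw [cP, cN, ← Finset.sum_add_distrib]
    zify
    refine le_trans (le_of_eq ?_) hd
    refine Finset.sum_congr rfl fun i _ => ?_
    rcases le_total (x i) (y i) with hh | hh
    · rw [abs_of_nonpos (by omega)]; omega
    · rw [abs_of_nonneg (by omega)]; omega
  have hbal : ∑ i, x i + N.card = ∑ i, y i + P.card := by
    rw [cP, cN, ← Finset.sum_add_distrib, ← Finset.sum_add_distrib]
    refine Finset.sum_congr rfl fun i _ => ?_
    omega
  have hmod : (∑ i, x i) % 5 = (∑ i, y i) % 5 := (ZMod.natCast_eq_natCast_iff' _ _ _).1 h5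
  have hcard : P.card = N.card := by omega
  have hPN : P = N := by
    have hle : P.card ≤ 2 := by omega
    obtain h0 | h1 | h2 : P.card = 0 ∨ P.card = 1 ∨ P.card = 2 := by omega
    · rw [Multiset.card_eq_zero.1 h0, Multiset.card_eq_zero.1 (hcard.symm.trans h0)]
    · obtain ⟨a, ha⟩ := Multiset.card_eq_one.1 h1
      obtain ⟨b, hb⟩ := Multiset.card_eq_one.1 (hcard ▸ h1)
      rw [ha, hb] at hprod ⊢
      simp at hprod
      rcases hs a a b b (by rw [hprod]) with h | h <;> rw [h.1]
    · obtain ⟨a, b, ha⟩ := Multiset.card_eq_two.1 h2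
      obtain ⟨c, d, hb⟩ := Multiset.card_eq_two.1 (hcard ▸ h2)
      rw [ha, hb] at hprod ⊢
      simp at hprod
      rcases hs a b c d hprod with h | h
      · rw [h.1, h.2]
      · rw [h.1, h.2, Multiset.pair_comm]
  funext i
  have := kP i
  rw [hPN, kN i] at this
  omega

theorem code12 (e1 e2 e3 : ℤ) (h : |e1| + |e2| + |e3| ≤ 3) (hm : (e1 + 3 * e2 + 5 * e3) % 12 = 0) :
    e1 = 0 ∧ e2 = 0 ∧ e3 = 0 := by
  obtain ⟨t, ht⟩ : ∃ t, e1 + 3 * e2 + 5 * e3 = 12 * t :=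
    ⟨(e1 + 3 * e2 + 5 * e3) / 12, by omega⟩
  have b1 := abs_le.1 (show |e1| ≤ 3 by have := abs_nonneg e2; have := abs_nonneg e3; omega)
  have b2 := abs_le.1 (show |e2| ≤ 3 by have := abs_nonneg e1; have := abs_nonneg e3; omega)
  rcases abs_cases e1 with ⟨a1, _⟩ | ⟨a1, _⟩ <;> rcases abs_cases e2 with ⟨a2, _⟩ | ⟨a2, _⟩ <;>
    rcases abs_cases e3 with ⟨a3, _⟩ | ⟨a3, _⟩ <;> rw [a1, a2, a3] at h <;> clear a1 a2 a3 hm <;>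
    obtain ⟨b1, c1⟩ := b1 <;> obtain ⟨b2, c2⟩ := b2 <;>
    interval_cases e1 <;> interval_cases e2 <;> omega

theorem code_exists (k M : ℕ) (hM : 12 * M ≤ (k + 1) * (k + 2) * (k + 3)) :
    ∃ S : Finset (ℕ × ℕ × ℕ), M ≤ S.card ∧
      (∀ y ∈ S, y.1 ≤ k ∧ y.2.1 ≤ k + 1 ∧ y.2.2 ≤ k + 2) ∧
      ∀ y ∈ S, ∀ z ∈ S, |(y.1 : ℤ) - z.1| + |(y.2.1 : ℤ) - z.2.1| + |(y.2.2 : ℤ) - z.2.2| ≤ 3 →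
        y = z := by
  let U : Finset (ℕ × ℕ × ℕ) :=
    Finset.range (k + 1) ×ˢ Finset.range (k + 2) ×ˢ Finset.range (k + 3)
  let f : ℕ × ℕ × ℕ → ℕ := fun y => (y.1 + 3 * y.2.1 + 5 * y.2.2) % 12
  obtain ⟨c, _, hc⟩ := Finset.exists_le_card_fiber_of_mul_le_card_of_maps_to
    (s := U) (t := Finset.range 12) (f := f) (n := M)
    (fun y _ => Finset.mem_range.2 (Nat.mod_lt _ (by norm_num))) ⟨0, by simp⟩ (by
      simp only [U, Finset.card_product, Finset.card_range]
      rw [← mul_assoc]; exact hM)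
  refine ⟨_, hc, ?_, ?_⟩
  · intro y hy
    simp [U] at hy
    omega
  · intro y hy z hz hd
    have h1 := (Finset.mem_filter.1 hy).2
    have h2 := (Finset.mem_filter.1 hz).2
    simp only [f] at h1 h2
    obtain ⟨g1, g2, g3⟩ := code12 _ _ _ hd (by omega)
    ext <;> omega

theorem main_aux (k : ℕ) (hk : 113 ≤ k) (hpp : IsPrimePow (k - 2)) :
    ∃ g : List ℤ → ℕ × ℕ × ℕ,
      (∀ σ, permList k σ → (g σ).1 ≤ k ∧ (g σ).2.1 ≤ k + 1 ∧ (g σ).2.2 ≤ k + 2) ∧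
      (∀ σ π, permList k σ → permList k π → σ ≠ π →
        ∀ n : ℕ, StepsTo n (enc k (g σ) σ) (enc k (g π) π) → 5 ≤ n) := by
  classical
  obtain ⟨j, rfl⟩ : ∃ j, k = j + 2 := ⟨k - 2, by omega⟩
  rw [Nat.add_sub_cancel] at hpp
  obtain ⟨G, _, _, h, hG, hs⟩ := sidon_exists j hpp
  let T := G × ZMod 5 × Fin 2
  have hT : Fintype.card T = 10 * (j ^ 2 - 1) := by
    simp only [T, Fintype.card_prod, hG, ZMod.card, Fintype.card_fin]; ring
  obtain ⟨S, hSc, hSb, hSd⟩ := code_exists (j + 2) (10 * (j ^ 2 - 1)) (by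
    have h1 : 12 * (10 * (j ^ 2 - 1)) ≤ 120 * (j ^ 2) := by omega
    obtain ⟨m, rfl⟩ : ∃ m, j = 111 + m := ⟨j - 111, by omega⟩
    have h2 : (111 + m) ^ 2 - 1 = m ^ 2 + 222 * m + 12320 := by
      have : (111 + m) ^ 2 = m ^ 2 + 222 * m + 12320 + 1 := by ring
      omega
    rw [h2]
    nlinarith [Nat.zero_le (m ^ 3), Nat.zero_le (m ^ 2), Nat.zero_le m])
  obtain ⟨φ⟩ : Nonempty (T ↪ S) := by
    apply Function.Embedding.nonempty_of_card_le
    rw [hT, Fintype.card_coe]; exact hSc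
  let x : List ℤ → Fin j → ℕ := fun σ i => invv ((i : ℕ) + 3 : ℤ) σ
  let col : List ℤ → T := fun σ =>
    (∏ i, h i ^ x σ i, ((∑ i, x σ i : ℕ) : ZMod 5), Fin.ofNat 2 (invv 2 σ))
  refine ⟨fun σ => (φ (col σ)).1, fun σ _ => hSb _ (φ (col σ)).2, ?_⟩
  intro σ π hσ hπ hne n hn
  by_contra hlt
  obtain ⟨a1, a2, a3⟩ := hSb _ (φ (col σ)).2
  obtain ⟨b1, b2, b3⟩ := hSb _ (φ (col π)).2
  obtain ⟨p, -, e, e1, e2, e3⟩ := enc_spec hσ _ a1 a2 a3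
  obtain ⟨p', -, f, f1, f2, f3⟩ := enc_spec hπ _ b1 b2 b3
  have hdist := fun s => (steps_dist n _ _ hn (permList_nodup p) s).trans
    (show (n : ℤ) ≤ 4 by omega)
  by_cases hc : col σ = col π
  · apply hne
    have c1 : ∏ i, h i ^ x σ i = ∏ i, h i ^ x π i := congrArg Prod.fst hc
    have c2 : ((∑ i, x σ i : ℕ) : ZMod 5) = ((∑ i, x π i : ℕ) : ZMod 5) :=
      congrArg (fun t => t.2.1) hc
    have c3 : invv 2 σ % 2 = invv 2 π % 2 := congrArg (fun t => t.2.2.val) hc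
    have hx : x σ = x π := by
      refine sidon_L1 h hs _ _ ?_ c2 c1
      have := hdist (Finset.univ.map ⟨fun i : Fin j => ((i : ℕ) + 3 : ℤ), fun a b hab => by
        ext; simpa using hab⟩)
      rw [Finset.sum_map] at this
      refine le_trans (le_of_eq (Finset.sum_congr rfl fun i _ => ?_)) this
      change _ = |(invv ((i : ℕ) + 3 : ℤ) (enc (j + 2) (φ (col σ)).1 σ) : ℤ) -
        invv ((i : ℕ) + 3 : ℤ) (enc (j + 2) (φ (col π)).1 π)|
      rw [e _ (by have := i.2; push_cast; omega), f _ (by have := i.2; push_cast; omega)]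
    apply invv_inj _ _ _ hσ hπ
    intro a ha1 ha2
    have u := invv_bound hσ a
    have v := invv_bound hπ a
    obtain rfl | rfl | ha3 : a = 1 ∨ a = 2 ∨ 3 ≤ a := by omega
    · simp at u v; omega
    · simp at u v; omega
    · have := congrFun hx ⟨(a - 3).toNat, by push_cast at ha2; omega⟩
      simp only [x] at this
      rwa [show ((a - 3).toNat : ℤ) + 3 = a by omega] at this
  · have hy : (φ (col σ)).1 ≠ (φ (col π)).1 := by
      intro hh; exact hc (φ.injective (Subtype.ext hh))
    -- some coordinate of the restriction differs
    obtain ⟨a, ha1, ha2, ha3⟩ : ∃ a : ℤ, 1 ≤ a ∧ a ≤ ((j + 2 : ℕ) : ℤ) ∧ invv a σ ≠ invv a π := by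
      by_contra hcon
      push Not at hcon
      exact hne (invv_inj _ _ _ hσ hπ hcon)
    have := hdist {a, ((j + 2 : ℕ) : ℤ) + 1, ((j + 2 : ℕ) : ℤ) + 2, ((j + 2 : ℕ) : ℤ) + 3}
    rw [Finset.sum_insert (by simp; omega), Finset.sum_insert (by simp),
      Finset.sum_insert (by simp), Finset.sum_singleton, e a ha2, f a ha2,
      e1, e2, e3, f1, f2, f3] at this
    apply hy
    apply hSd _ (φ (col σ)).2 _ (φ (col π)).2
    have : 1 ≤ |(invv a σ : ℤ) - invv a π| := Int.one_le_abs (by omega)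
    linarith

/-- Example 4. For every integer `k ≥ 113` such that `k - 2` is a power
of a prime, there exists a `(k+3, k)` systematic double-error-correcting code: a code
`C ⊆ S_{k+3}` of size `k!` such that every `σ ∈ S_k` is the restriction of exactly one
codeword of `C`, and distinct codewords of `C` are at Kendall τ-distance at least `5`. -/
theorem stmt16 (k : ℕ) (hk : 113 ≤ k) (hpp : IsPrimePow (k - 2)) :
    ∃ C : Set (List ℤ),
      (∀ α ∈ C, permList (k + 3) α) ∧
      C.ncard = Nat.factorial k ∧
      (∀ σ : List ℤ, permList k σ → ∃! α, α ∈ C ∧ restrictTo k α = σ) ∧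
      (∀ α ∈ C, ∀ β ∈ C, α ≠ β → 5 ≤ dK α β) := by
  obtain ⟨g, hg, hd⟩ := main_aux k hk hpp
  have hspec : ∀ σ, permList k σ → permList (k + 3) (enc k (g σ) σ) ∧
      restrictTo k (enc k (g σ) σ) = σ := fun σ hσ => by
    obtain ⟨a, b, c⟩ := hg σ hσ
    have := enc_spec hσ (g σ) a b c
    exact ⟨this.1, this.2.1⟩
  refine ⟨(fun σ => enc k (g σ) σ) '' {σ | permList k σ}, ?_, ?_, ?_, ?_⟩
  · rintro _ ⟨σ, hσ, rfl⟩
    exact (hspec σ hσ).1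
  · rw [Set.InjOn.ncard_image, ncard_perm]
    intro σ hσ π hπ he
    rw [← (hspec σ hσ).2, ← (hspec π hπ).2]
    exact congrArg (restrictTo k) he
  · intro σ hσ
    refine ⟨enc k (g σ) σ, ⟨⟨σ, hσ, rfl⟩, (hspec σ hσ).2⟩, ?_⟩
    rintro _ ⟨⟨π, hπ, rfl⟩, he⟩
    have : π = σ := (hspec π hπ).2.symm.trans he
    rw [this]
  · rintro _ ⟨σ, hσ, rfl⟩ _ ⟨π, hπ, rfl⟩ hne
    have hne' : σ ≠ π := fun e => hne (by rw [e])
    have hperm : (enc k (g σ) σ).Perm (enc k (g π) π) :=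
      Multiset.coe_eq_coe.1 (((hspec σ hσ).1 : _ = _).trans ((hspec π hπ).1 : _ = _).symm)
    exact hd σ π hσ hπ hne' _ (Nat.sInf_mem (s := {n | StepsTo n _ _}) (steps_exists hperm))
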